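/- GLP.3 is itself a non-degenerate normal extension of GLP, every non-degenerate normal extension of GLP is contained in GLP.3 (so GLP.3 is the largest non-degenerate normal extension of GLP), and GLP.3 equals the set of L_{[<ω]}-formulas all of whose closed substitutions are theorems of GLP. -/

import Mathlib

/-- Formulas of the polymodal language `L_{[<ω]}`: propositional variables,
a constant ⊤, Boolean connectives, and a modality `[m]` for each `m : ℕ`. -/
inductive Formula : Type
  | var : ℕ → Formula
  | top : Formula
  | neg : Formula → Formula
  | and : Formula → Formula → Formula
  | or : Formula → Formula → Formula
  | imp : Formula → Formula → Formula
  | box : ℕ → Formula → Formula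
  deriving DecidableEq

namespace Formula

/-- `⊥` abbreviates `¬⊤`. -/
def bot : Formula := neg top

/-- `⟨m⟩φ` abbreviates `¬[m]¬φ`. -/
def dia (m : ℕ) (φ : Formula) : Formula := neg (box m (neg φ))

/-- A formula is closed if it contains no propositional variables. -/
def Closed : Formula → Prop
  | var _ => False
  | top => True
  | neg a => Closed a
  | and a b => Closed a ∧ Closed b
  | or a b => Closed a ∧ Closed b
  | imp a b => Closed a ∧ Closed b
  | box _ a => Closed a

/-- Membership in the language `L_{[<n]}`: all modalities `[m]` have `m < n`. -/
def InLang (n : ℕ) : Formula → Prop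
  | var _ => True
  | top => True
  | neg a => InLang n a
  | and a b => InLang n a ∧ InLang n b
  | or a b => InLang n a ∧ InLang n b
  | imp a b => InLang n a ∧ InLang n b
  | box m a => m < n ∧ InLang n a

/-- Uniform substitution of formulas for propositional variables. -/
def subst (σ : ℕ → Formula) : Formula → Formula
  | var i => σ i
  | top => top
  | neg a => neg (subst σ a)
  | and a b => and (subst σ a) (subst σ b)
  | or a b => or (subst σ a) (subst σ b)
  | imp a b => imp (subst σ a) (subst σ b)
  | box m a => box m (subst σ a)

/-- The number of occurrences of modal operators in a formula
(diamonds `⟨m⟩` are abbreviations `¬[m]¬`, so each is one box occurrence). -/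
def modalCount : Formula → ℕ
  | var _ => 0
  | top => 0
  | neg a => modalCount a
  | and a b => modalCount a + modalCount b
  | or a b => modalCount a + modalCount b
  | imp a b => modalCount a + modalCount b
  | box _ a => modalCount a + 1

end Formula

/-- Conjunction of a finite list of formulas. -/
def bigConj (l : List Formula) : Formula := l.foldr Formula.and Formula.top

/-- `⋀_{m ≤ k < n} [k]φ`. -/
def boxConj (m n : ℕ) (φ : Formula) : Formula :=
  bigConj ((List.range' m (n - m)).map fun k => Formula.box k φ)

/-- The pseudo-linearity axiom
`[m]((⋀_{m≤k<n}[k]φ) → ψ) ∨ [m]((⋀_{m≤k<n}[k]ψ ∧ ψ) → φ)`. -/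
def psLin (n m : ℕ) (φ ψ : Formula) : Formula :=
  Formula.or
    (Formula.box m (Formula.imp (boxConj m n φ) ψ))
    (Formula.box m (Formula.imp (Formula.and (boxConj m n ψ) ψ) φ))

/-- A Boolean valuation of formulas respecting the Boolean connectives
(treating boxed formulas and variables as atoms). -/
def RespectsBool (v : Formula → Bool) : Prop :=
  v Formula.top = true ∧
  (∀ a, v (Formula.neg a) = !(v a)) ∧
  (∀ a b, v (Formula.and a b) = (v a && v b)) ∧
  (∀ a b, v (Formula.or a b) = (v a || v b)) ∧
  (∀ a b, v (Formula.imp a b) = (!(v a) || v b))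

/-- Propositional tautologies of the modal language. -/
def Tautology (φ : Formula) : Prop :=
  ∀ v : Formula → Bool, RespectsBool v → v φ = true

/-- Japaridze's polymodal provability logic `GLP`. -/
inductive GLP : Formula → Prop
  | taut {φ : Formula} : Tautology φ → GLP φ
  | distr (m : ℕ) (φ ψ : Formula) :
      GLP (Formula.imp (Formula.box m (Formula.imp φ ψ))
        (Formula.imp (Formula.box m φ) (Formula.box m ψ)))
  | lob (m : ℕ) (φ : Formula) :
      GLP (Formula.imp (Formula.box m (Formula.imp (Formula.box m φ) φ)) (Formula.box m φ))
  | mono (m : ℕ) (φ : Formula) :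
      GLP (Formula.imp (Formula.box m φ) (Formula.box (m + 1) φ))
  | diaMono (m : ℕ) (φ : Formula) :
      GLP (Formula.imp (Formula.dia m φ) (Formula.box (m + 1) (Formula.dia m φ)))
  | mp {φ ψ : Formula} : GLP (Formula.imp φ ψ) → GLP φ → GLP ψ
  | nec (m : ℕ) {φ : Formula} : GLP φ → GLP (Formula.box m φ)

/-- The logic `GLP.3`: `GLP` together with the linearity axioms
`[m]([m]A → B) ∨ [m]([m]B ∧ B → A)`. -/
inductive GLP3 : Formula → Prop
  | taut {φ : Formula} : Tautology φ → GLP3 φ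
  | distr (m : ℕ) (φ ψ : Formula) :
      GLP3 (Formula.imp (Formula.box m (Formula.imp φ ψ))
        (Formula.imp (Formula.box m φ) (Formula.box m ψ)))
  | lob (m : ℕ) (φ : Formula) :
      GLP3 (Formula.imp (Formula.box m (Formula.imp (Formula.box m φ) φ)) (Formula.box m φ))
  | mono (m : ℕ) (φ : Formula) :
      GLP3 (Formula.imp (Formula.box m φ) (Formula.box (m + 1) φ))
  | diaMono (m : ℕ) (φ : Formula) :
      GLP3 (Formula.imp (Formula.dia m φ) (Formula.box (m + 1) (Formula.dia m φ)))
  | lin (m : ℕ) (A B : Formula) :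
      GLP3 (Formula.or (Formula.box m (Formula.imp (Formula.box m A) B))
        (Formula.box m (Formula.imp (Formula.and (Formula.box m B) B) A)))
  | mp {φ ψ : Formula} : GLP3 (Formula.imp φ ψ) → GLP3 φ → GLP3 ψ
  | nec (m : ℕ) {φ : Formula} : GLP3 φ → GLP3 (Formula.box m φ)

/-- The logic `GLP_n`, i.e. `GLP` restricted to the language `L_{[<n]}`. -/
inductive GLPn (n : ℕ) : Formula → Prop
  | taut {φ : Formula} : Tautology φ → Formula.InLang n φ → GLPn n φ
  | distr {m : ℕ} (hm : m < n) (φ ψ : Formula)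
      (hφ : Formula.InLang n φ) (hψ : Formula.InLang n ψ) :
      GLPn n (Formula.imp (Formula.box m (Formula.imp φ ψ))
        (Formula.imp (Formula.box m φ) (Formula.box m ψ)))
  | lob {m : ℕ} (hm : m < n) (φ : Formula) (hφ : Formula.InLang n φ) :
      GLPn n (Formula.imp (Formula.box m (Formula.imp (Formula.box m φ) φ)) (Formula.box m φ))
  | mono {m : ℕ} (hm : m + 1 < n) (φ : Formula) (hφ : Formula.InLang n φ) :
      GLPn n (Formula.imp (Formula.box m φ) (Formula.box (m + 1) φ))
  | diaMono {m : ℕ} (hm : m + 1 < n) (φ : Formula) (hφ : Formula.InLang n φ) :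
      GLPn n (Formula.imp (Formula.dia m φ) (Formula.box (m + 1) (Formula.dia m φ)))
  | mp {φ ψ : Formula} : GLPn n (Formula.imp φ ψ) → GLPn n φ → GLPn n ψ
  | nec {m : ℕ} (hm : m < n) {φ : Formula} : GLPn n φ → GLPn n (Formula.box m φ)

/-- The logic `GLP_n.3`: `GLP_n` with the linearity axioms for each `m < n`. -/
inductive GLPn3 (n : ℕ) : Formula → Prop
  | taut {φ : Formula} : Tautology φ → Formula.InLang n φ → GLPn3 n φ
  | distr {m : ℕ} (hm : m < n) (φ ψ : Formula)
      (hφ : Formula.InLang n φ) (hψ : Formula.InLang n ψ) :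
      GLPn3 n (Formula.imp (Formula.box m (Formula.imp φ ψ))
        (Formula.imp (Formula.box m φ) (Formula.box m ψ)))
  | lob {m : ℕ} (hm : m < n) (φ : Formula) (hφ : Formula.InLang n φ) :
      GLPn3 n (Formula.imp (Formula.box m (Formula.imp (Formula.box m φ) φ)) (Formula.box m φ))
  | mono {m : ℕ} (hm : m + 1 < n) (φ : Formula) (hφ : Formula.InLang n φ) :
      GLPn3 n (Formula.imp (Formula.box m φ) (Formula.box (m + 1) φ))
  | diaMono {m : ℕ} (hm : m + 1 < n) (φ : Formula) (hφ : Formula.InLang n φ) :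
      GLPn3 n (Formula.imp (Formula.dia m φ) (Formula.box (m + 1) (Formula.dia m φ)))
  | lin {m : ℕ} (hm : m < n) (A B : Formula)
      (hA : Formula.InLang n A) (hB : Formula.InLang n B) :
      GLPn3 n (Formula.or (Formula.box m (Formula.imp (Formula.box m A) B))
        (Formula.box m (Formula.imp (Formula.and (Formula.box m B) B) A)))
  | mp {φ ψ : Formula} : GLPn3 n (Formula.imp φ ψ) → GLPn3 n φ → GLPn3 n ψ
  | nec {m : ℕ} (hm : m < n) {φ : Formula} : GLPn3 n φ → GLPn3 n (Formula.box m φ)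

/-- Beklemishev's logic `J_n`. -/
inductive Jn (n : ℕ) : Formula → Prop
  | taut {φ : Formula} : Tautology φ → Formula.InLang n φ → Jn n φ
  | distr {k : ℕ} (hk : k < n) (φ ψ : Formula)
      (hφ : Formula.InLang n φ) (hψ : Formula.InLang n ψ) :
      Jn n (Formula.imp (Formula.box k (Formula.imp φ ψ))
        (Formula.imp (Formula.box k φ) (Formula.box k ψ)))
  | lob {k : ℕ} (hk : k < n) (φ : Formula) (hφ : Formula.InLang n φ) :
      Jn n (Formula.imp (Formula.box k (Formula.imp (Formula.box k φ) φ)) (Formula.box k φ))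
  | trans1 {k m : ℕ} (hkm : k ≤ m) (hm : m < n) (φ : Formula) (hφ : Formula.InLang n φ) :
      Jn n (Formula.imp (Formula.box k φ) (Formula.box k (Formula.box m φ)))
  | trans2 {k m : ℕ} (hkm : k ≤ m) (hm : m < n) (φ : Formula) (hφ : Formula.InLang n φ) :
      Jn n (Formula.imp (Formula.box k φ) (Formula.box m (Formula.box k φ)))
  | diaMono {k m : ℕ} (hkm : k < m) (hm : m < n) (φ : Formula) (hφ : Formula.InLang n φ) :
      Jn n (Formula.imp (Formula.dia k φ) (Formula.box m (Formula.dia k φ)))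
  | mp {φ ψ : Formula} : Jn n (Formula.imp φ ψ) → Jn n φ → Jn n ψ
  | nec {k : ℕ} (hk : k < n) {φ : Formula} : Jn n φ → Jn n (Formula.box k φ)

/-- The logic `J_n.lin`: `J_n` together with the pseudo-linearity axioms. -/
inductive JnLin (n : ℕ) : Formula → Prop
  | taut {φ : Formula} : Tautology φ → Formula.InLang n φ → JnLin n φ
  | distr {k : ℕ} (hk : k < n) (φ ψ : Formula)
      (hφ : Formula.InLang n φ) (hψ : Formula.InLang n ψ) :
      JnLin n (Formula.imp (Formula.box k (Formula.imp φ ψ))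
        (Formula.imp (Formula.box k φ) (Formula.box k ψ)))
  | lob {k : ℕ} (hk : k < n) (φ : Formula) (hφ : Formula.InLang n φ) :
      JnLin n (Formula.imp (Formula.box k (Formula.imp (Formula.box k φ) φ)) (Formula.box k φ))
  | trans1 {k m : ℕ} (hkm : k ≤ m) (hm : m < n) (φ : Formula) (hφ : Formula.InLang n φ) :
      JnLin n (Formula.imp (Formula.box k φ) (Formula.box k (Formula.box m φ)))
  | trans2 {k m : ℕ} (hkm : k ≤ m) (hm : m < n) (φ : Formula) (hφ : Formula.InLang n φ) :
      JnLin n (Formula.imp (Formula.box k φ) (Formula.box m (Formula.box k φ)))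
  | diaMono {k m : ℕ} (hkm : k < m) (hm : m < n) (φ : Formula) (hφ : Formula.InLang n φ) :
      JnLin n (Formula.imp (Formula.dia k φ) (Formula.box m (Formula.dia k φ)))
  | lin {m : ℕ} (hm : m < n) (φ ψ : Formula)
      (hφ : Formula.InLang n φ) (hψ : Formula.InLang n ψ) :
      JnLin n (psLin n m φ ψ)
  | mp {φ ψ : Formula} : JnLin n (Formula.imp φ ψ) → JnLin n φ → JnLin n ψ
  | nec {k : ℕ} (hk : k < n) {φ : Formula} : JnLin n φ → JnLin n (Formula.box k φ)

section Frames

variable {T : Type*}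

/-- `(T, <_0, …, <_{n-1})` (encoded as `R : ℕ → T → T → Prop`, only the
relations `R i` for `i < n` being relevant) is a `J_n`-frame. -/
def IsJnFrame (n : ℕ) (R : ℕ → T → T → Prop) : Prop :=
  (∀ i < n, Irreflexive (R i)) ∧
  (∀ i < n, Transitive (R i)) ∧
  (∀ i < n, WellFounded fun a b => R i b a) ∧
  ∀ ⦃k m : ℕ⦄, k < m → m < n →
    (∀ ⦃x y z : T⦄, R m x y → R k y z → R k x z) ∧
    (∀ ⦃x y z : T⦄, R k x y → R m y z → R k x z) ∧
    (∀ ⦃x y z : T⦄, R k x z → R m y z → R k x y)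

/-- A frame is hereditarily linear if any two distinct points are comparable
by some relation `<_k`, `k < n`. -/
def HereditarilyLinear (n : ℕ) (R : ℕ → T → T → Prop) : Prop :=
  ∀ x y : T, x ≠ y → ∃ k < n, R k x y ∨ R k y x

/-- A frame is stratified if `x <_m y` and `z <_k y` imply `x <_m z` for `k < m < n`. -/
def Stratified (n : ℕ) (R : ℕ → T → T → Prop) : Prop :=
  ∀ ⦃k m : ℕ⦄, k < m → m < n → ∀ ⦃x y z : T⦄, R m x y → R k z y → R m x z

/-- The relations `≡_k` (for `k ≤ n`): `≡_n` is identity and `≡_k` is the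
equivalence relation generated by the union of `<_k` and `≡_{k+1}`.
Equivalence classes of `≡_k` are the `k`-planes. -/
def eqvRel (R : ℕ → T → T → Prop) (n : ℕ) (k : ℕ) : T → T → Prop :=
  if _ : k < n then
    Relation.EqvGen fun x y => R k x y ∨ eqvRel R n (k + 1) x y
  else Eq
termination_by n - k
decreasing_by omega

/-- Kripke satisfaction in the model `(T, R, V)`. -/
def Sat (R : ℕ → T → T → Prop) (V : ℕ → T → Prop) : T → Formula → Prop
  | w, Formula.var p => V p w
  | _, Formula.top => True
  | w, Formula.neg a => ¬ Sat R V w a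
  | w, Formula.and a b => Sat R V w a ∧ Sat R V w b
  | w, Formula.or a b => Sat R V w a ∨ Sat R V w b
  | w, Formula.imp a b => Sat R V w a → Sat R V w b
  | w, Formula.box m a => ∀ v : T, R m w v → Sat R V v a

end Frames

/-- A set of formulas is consistent with the logic `L` if no finite conjunction
of its elements has its negation provable in `L`. -/
def SetConsistent (L : Formula → Prop) (S : Set Formula) : Prop :=
  ∀ l : List Formula, (∀ φ ∈ l, φ ∈ S) → ¬ L (Formula.neg (bigConj l))

/-- A maximal `L`-consistent set of `L_{[<n]}`-formulas. -/
def MCS (L : Formula → Prop) (n : ℕ) (S : Set Formula) : Prop :=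
  (∀ φ ∈ S, Formula.InLang n φ) ∧ SetConsistent L S ∧
  ∀ S' : Set Formula, (∀ φ ∈ S', Formula.InLang n φ) → S ⊆ S' → S ≠ S' → ¬ SetConsistent L S'

/-- The canonical accessibility relation `x <_m y`. -/
def canonR (m : ℕ) (x y : Set Formula) : Prop :=
  (∀ ψ : Formula, Formula.box m ψ ∈ x → ψ ∈ y) ∧
  (∃ ψ : Formula, Formula.box m ψ ∈ y ∧ Formula.box m ψ ∉ x)

/-- A set of formulas is `k`-maximal if it contains `¬ψ ∧ ⋀_{k≤m<n}[m]ψ` for some `ψ`. -/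
def kMaximal (n k : ℕ) (S : Set Formula) : Prop :=
  ∃ ψ : Formula, Formula.and (Formula.neg ψ) (boxConj k n ψ) ∈ S

/-- A normal extension of `GLP`: contains all theorems of `GLP` and all
distribution axioms, and is closed under modus ponens, necessitation for each
modality, and uniform substitution. -/
def NormalExtGLP (S : Set Formula) : Prop :=
  (∀ φ : Formula, GLP φ → φ ∈ S) ∧
  (∀ (m : ℕ) (φ ψ : Formula),
    Formula.imp (Formula.box m (Formula.imp φ ψ))
      (Formula.imp (Formula.box m φ) (Formula.box m ψ)) ∈ S) ∧
  (∀ φ ψ : Formula, Formula.imp φ ψ ∈ S → φ ∈ S → ψ ∈ S) ∧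
  (∀ (m : ℕ) (φ : Formula), φ ∈ S → Formula.box m φ ∈ S) ∧
  (∀ (σ : ℕ → Formula) (φ : Formula), φ ∈ S → Formula.subst σ φ ∈ S)

/-- A logic is non-degenerate if it contains no formula `[m]^k ⊥`. -/
def NonDegenerate (S : Set Formula) : Prop :=
  ∀ m k : ℕ, (fun ψ => Formula.box m ψ)^[k] Formula.bot ∉ S

/-! ### Boolean valuations extending a theory -/

/-- A set of formulas containing all tautologies and closed under modus ponens, and omitting `φ`,
is contained in the set of formulas true under some Boolean valuation refuting `φ`. -/
theorem exists_valuation {Γ : Formula → Prop} (htaut : ∀ ψ, Tautology ψ → Γ ψ)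
    (hmp : ∀ ψ χ, Γ (Formula.imp ψ χ) → Γ ψ → Γ χ) {φ : Formula} (hφ : ¬ Γ φ) :
    ∃ v : Formula → Bool, RespectsBool v ∧ (∀ ψ, Γ ψ → v ψ = true) ∧ v φ = false := by
  classical
  have hev : ∀ ψ : Formula, Continuous fun v : Formula → Bool => v ψ := fun ψ => continuous_apply ψ
  have hclosed : IsClosed {v : Formula → Bool | RespectsBool v ∧ v φ = false} := by
    simp only [RespectsBool, Set.ofPred_and, Set.ofPred_forall]
    have hneg : Continuous fun b : Bool => !b := continuous_of_discreteTopology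
    have hand : Continuous fun b : Bool × Bool => b.1 && b.2 := continuous_of_discreteTopology
    have hor : Continuous fun b : Bool × Bool => b.1 || b.2 := continuous_of_discreteTopology
    refine .inter (.inter ?_ (.inter ?_ (.inter ?_ (.inter ?_ ?_)))) ?_
    · exact isClosed_eq (hev _) continuous_const
    · exact isClosed_iInter fun a => isClosed_eq (hev _) (hneg.comp (hev a))
    · exact isClosed_iInter fun a => isClosed_iInter fun b =>
        isClosed_eq (hev _) (hand.comp ((hev a).prodMk (hev b)))
    · exact isClosed_iInter fun a => isClosed_iInter fun b =>
        isClosed_eq (hev _) (hor.comp ((hev a).prodMk (hev b)))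
    · exact isClosed_iInter fun a => isClosed_iInter fun b =>
        isClosed_eq (hev _) (hor.comp ((hneg.comp (hev a)).prodMk (hev b)))
    · exact isClosed_eq (hev _) continuous_const
  obtain ⟨v, ⟨hv, hvφ⟩, hvΓ⟩ :
      ({v : Formula → Bool | RespectsBool v ∧ v φ = false} ∩
        ⋂ ψ : {ψ // Γ ψ}, {v : Formula → Bool | v ψ.1 = true}).Nonempty := by
    refine hclosed.isCompact.inter_iInter_nonempty _
      (fun ψ => isClosed_eq (hev _) continuous_const) fun u => ?_
    by_contra hne
    have hderiv : ∀ l : List {ψ // Γ ψ}, ∀ χ : Formula,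
        Γ (l.foldr (fun ψ θ => Formula.imp ψ.1 θ) χ) → Γ χ := by
      intro l χ
      induction l with
      | nil => exact id
      | cons ψ l ih => exact fun h => ih (hmp _ _ h ψ.2)
    refine hφ (hderiv u.toList φ (htaut _ fun v hv => ?_))
    have hfold : ∀ l : List {ψ // Γ ψ}, ((∀ ψ ∈ l, v ψ.1 = true) → v φ = true) →
        v (l.foldr (fun ψ θ => Formula.imp ψ.1 θ) φ) = true := by
      intro l
      induction l with
      | nil => intro h; exact h (by simp)
      | cons ψ l ih =>
        intro h
        rw [List.foldr_cons, hv.2.2.2.2]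
        cases hψ : v ψ.1
        · rfl
        · rw [ih fun hl => h fun χ hχ => ?_]
          · rfl
          · rcases List.mem_cons.1 hχ with rfl | hχ
            · exact hψ
            · exact hl χ hχ
    refine hfold _ fun hu => ?_
    by_contra hvφ
    exact hne ⟨v, ⟨hv, by simpa using hvφ⟩, by simpa using hu⟩
  exact ⟨v, hv, fun ψ hψ => Set.mem_iInter.1 hvΓ ⟨ψ, hψ⟩, hvφ⟩

/-! ### The canonical model of a logic extending `GLP` -/

/-- Logics that contain the axioms of `GLP` and are closed under its rules. -/
class ExtendsGLP (L : Formula → Prop) : Prop where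
  taut {φ : Formula} : Tautology φ → L φ
  distr (m : ℕ) (φ ψ : Formula) :
    L (Formula.imp (Formula.box m (Formula.imp φ ψ))
      (Formula.imp (Formula.box m φ) (Formula.box m ψ)))
  lob (m : ℕ) (φ : Formula) :
    L (Formula.imp (Formula.box m (Formula.imp (Formula.box m φ) φ)) (Formula.box m φ))
  mono (m : ℕ) (φ : Formula) : L (Formula.imp (Formula.box m φ) (Formula.box (m + 1) φ))
  diaMono (m : ℕ) (φ : Formula) :
    L (Formula.imp (Formula.dia m φ) (Formula.box (m + 1) (Formula.dia m φ)))
  mp {φ ψ : Formula} : L (Formula.imp φ ψ) → L φ → L ψ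
  nec (m : ℕ) {φ : Formula} : L φ → L (Formula.box m φ)

instance : ExtendsGLP GLP :=
  ⟨.taut, .distr, .lob, .mono, .diaMono, .mp, .nec⟩

instance : ExtendsGLP GLP3 :=
  ⟨.taut, .distr, .lob, .mono, .diaMono, .mp, .nec⟩

/-- A world of the canonical model of `L`: a Boolean valuation making all theorems of `L` true. -/
structure World (L : Formula → Prop) where
  val : Formula → Bool
  respects : RespectsBool val
  thm : ∀ φ, L φ → val φ = true

namespace World

variable {L : Formula → Prop}

/-- Truth of a formula at a world. -/
def Holds (x : World L) (φ : Formula) : Prop := x.val φ = true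

/-- The canonical accessibility relation of `[k]`. -/
def Rel (k : ℕ) (x y : World L) : Prop := ∀ φ, x.Holds (.box k φ) → y.Holds φ

theorem holds_top (x : World L) : x.Holds .top := x.respects.1

@[simp] theorem holds_neg {x : World L} {a : Formula} : x.Holds (.neg a) ↔ ¬ x.Holds a := by
  simp [Holds, x.respects.2.1]

@[simp] theorem holds_and {x : World L} {a b : Formula} :
    x.Holds (.and a b) ↔ x.Holds a ∧ x.Holds b := by
  simp [Holds, x.respects.2.2.1]

@[simp] theorem holds_or {x : World L} {a b : Formula} :
    x.Holds (.or a b) ↔ x.Holds a ∨ x.Holds b := by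
  simp [Holds, x.respects.2.2.2.1]

@[simp] theorem holds_imp {x : World L} {a b : Formula} :
    x.Holds (.imp a b) ↔ (x.Holds a → x.Holds b) := by
  simp only [Holds, x.respects.2.2.2.2]
  cases x.val a <;> simp

theorem not_holds_bot (x : World L) : ¬ x.Holds .bot := by
  simp [Formula.bot, holds_top]

theorem ext_holds {x y : World L} (h : ∀ φ, x.Holds φ ↔ y.Holds φ) : x = y := by
  have : x.val = y.val := funext fun φ => Bool.eq_iff_iff.2 (h φ)
  cases x; cases y; cases this; rfl

variable [ExtendsGLP L]

theorem holds_distr {x : World L} {k : ℕ} {a b : Formula} (h : x.Holds (.box k (.imp a b)))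
    (ha : x.Holds (.box k a)) : x.Holds (.box k b) :=
  holds_imp.1 (holds_imp.1 (x.thm _ (ExtendsGLP.distr k a b)) h) ha

/-- Completeness of a logic with respect to its canonical model. -/
theorem complete {φ : Formula} (h : ∀ x : World L, x.Holds φ) : L φ := by
  by_contra hφ
  obtain ⟨v, hv, hL, hvφ⟩ := exists_valuation (Γ := L) (fun _ => ExtendsGLP.taut)
    (fun _ _ => ExtendsGLP.mp) hφ
  have := h ⟨v, hv, hL⟩
  simp [Holds, hvφ] at this

theorem holds_box {x : World L} {k : ℕ} {a : Formula} :
    x.Holds (.box k a) ↔ ∀ y, Rel k x y → y.Holds a := by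
  refine ⟨fun h y hy => hy _ h, fun h => ?_⟩
  by_contra ha
  obtain ⟨v, hv, hΓ, hva⟩ := exists_valuation (Γ := fun ψ => x.Holds (.box k ψ))
    (fun ψ hψ => x.thm _ (ExtendsGLP.nec k (ExtendsGLP.taut hψ)))
    (fun ψ χ => holds_distr) ha
  have := h ⟨v, hv, fun φ hφ => hΓ _ (x.thm _ (ExtendsGLP.nec k hφ))⟩ hΓ
  simp [Holds, hva] at this

theorem holds_dia {x : World L} {k : ℕ} {a : Formula} :
    x.Holds (.dia k a) ↔ ∃ y, Rel k x y ∧ y.Holds a := by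
  simp [Formula.dia, holds_box]

theorem lob_box {x : World L} {k : ℕ} {a : Formula} (h : ¬ x.Holds (.box k a)) :
    ∃ y, Rel k x y ∧ y.Holds (.box k a) ∧ ¬ y.Holds a := by
  by_contra! hy
  exact h (holds_imp.1 (x.thm _ (ExtendsGLP.lob k a))
    (holds_box.2 fun y hxy => holds_imp.2 (hy y hxy)))

theorem lob_dia {x : World L} {k : ℕ} {a : Formula} (h : x.Holds (.dia k a)) :
    ∃ y, Rel k x y ∧ y.Holds a ∧ ¬ y.Holds (.dia k a) := by
  obtain ⟨y, hxy, h₁, h₂⟩ := lob_box (holds_neg.1 h)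
  exact ⟨y, hxy, by simpa using h₂, fun h => holds_neg.1 h h₁⟩

theorem box_box {x : World L} {k : ℕ} {a : Formula} (h : x.Holds (.box k a)) :
    x.Holds (.box k (.box k a)) := by
  have hb : x.Holds (.box k (.and (.box k a) a)) := by
    by_contra hb
    obtain ⟨y, hxy, h₁, h₂⟩ := lob_box hb
    exact h₂ (holds_and.2 ⟨holds_box.2 fun z hz => (holds_and.1 (hz _ h₁)).2, hxy _ h⟩)
  exact holds_box.2 fun y hy => (holds_and.1 (hy _ hb)).1

theorem Rel.trans {k : ℕ} {x y z : World L} (h₁ : Rel k x y) (h₂ : Rel k y z) : Rel k x z :=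
  fun _ h => h₂ _ (h₁ _ (box_box h))

theorem Rel.of_le {k m : ℕ} (hkm : k ≤ m) {x y : World L} (h : Rel m x y) : Rel k x y := by
  induction m, hkm using Nat.le_induction with
  | base => exact h
  | succ m _ ih => exact ih fun φ hφ => h φ (holds_imp.1 (x.thm _ (ExtendsGLP.mono m φ)) hφ)

/-- Worlds related by `Rel m` agree on `⟨k⟩`-formulas for `k < m`. -/
theorem Rel.dia_iff {k m : ℕ} (hkm : k < m) {x y : World L} (h : Rel m x y) {a : Formula} :
    x.Holds (.dia k a) ↔ y.Holds (.dia k a) := by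
  refine ⟨fun hx => h.of_le hkm _ (holds_imp.1 (x.thm _ (ExtendsGLP.diaMono k a)) hx),
    fun hy => ?_⟩
  obtain ⟨z, hyz, hz⟩ := holds_dia.1 hy
  exact holds_dia.2 ⟨z, (h.of_le hkm.le).trans hyz, hz⟩

theorem Rel.box_iff {k m : ℕ} (hkm : k < m) {x y : World L} (h : Rel m x y) {a : Formula} :
    x.Holds (.box k a) ↔ y.Holds (.box k a) := by
  have := h.dia_iff hkm (a := .neg a)
  simp only [holds_dia, holds_neg] at this
  rw [holds_box, holds_box, ← not_iff_not]
  simpa using this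

/-- The successors of a world of the canonical model of `GLP.3` are linearly ordered. -/
theorem Rel.linear {k : ℕ} {x y z : World GLP3} (hy : Rel k x y) (hz : Rel k x z) :
    y = z ∨ Rel k y z ∨ Rel k z y := by
  by_contra! h
  obtain ⟨hne, hyz, hzy⟩ := h
  obtain ⟨a, ha, haz⟩ : ∃ a, y.Holds (.box k a) ∧ ¬ z.Holds a := by simpa [Rel] using hyz
  obtain ⟨b, hb, hby⟩ : ∃ b, z.Holds (.box k b) ∧ ¬ y.Holds b := by simpa [Rel] using hzy
  obtain ⟨c, hcz, hcy⟩ : ∃ c, z.Holds c ∧ ¬ y.Holds c := by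
    by_contra! hc
    refine hne (ext_holds fun φ => ⟨fun h => ?_, hc φ⟩)
    by_contra hφ
    exact holds_neg.1 (hc (.neg φ) (holds_neg.2 hφ)) h
  rcases holds_or.1 (x.thm _ (GLP3.lin k a (.or b c))) with h | h
  · rcases holds_or.1 (holds_imp.1 (hy _ h) ha) with h | h
    · exact hby h
    · exact hcy h
  · refine haz (holds_imp.1 (hz _ h) (holds_and.2 ⟨holds_box.2 fun w hw => ?_, ?_⟩))
    · exact holds_or.2 (.inl (hw _ hb))
    · exact holds_or.2 (.inr hcz)

end World

/-! ### Worms and the closed fragment of `GLP` -/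

/-- Trees representing iterated consistency statements. -/
inductive Worm : Type
  | one : Worm
  | up : Worm → Worm
  | node : Worm → Worm → Worm

namespace Worm

open World

/-- The closed formula represented by a worm at level `k`. -/
def toFormula : ℕ → Worm → Formula
  | _, one => .top
  | k, up a => toFormula (k + 1) a
  | k, node a b => .and (toFormula (k + 1) a) (.dia k (toFormula k b))

/-- The part of a worm lying at the next level. -/
def front : Worm → Worm
  | one => one
  | up a => a
  | node a _ => a

/-- The argument of the outermost modality of the current level, if there is one. -/
def rest : Worm → Option Worm
  | one => none
  | up _ => none
  | node _ b => some b

variable {L : Formula → Prop}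

theorem holds_iff_front_rest {k : ℕ} {a : Worm} {x : World L} :
    x.Holds (a.toFormula k) ↔ x.Holds (a.front.toFormula (k + 1)) ∧
      ∀ b ∈ a.rest, x.Holds (.dia k (b.toFormula k)) := by
  cases a <;> simp [front, rest, toFormula]

theorem holds_rest {k : ℕ} {a b : Worm} (hb : b ∈ a.rest) {x : World L}
    (h : x.Holds (a.toFormula k)) : x.Holds (.dia k (b.toFormula k)) :=
  (holds_iff_front_rest.1 h).2 b hb

theorem sizeOf_front_le (a : Worm) : sizeOf a.front ≤ sizeOf a := by
  cases a <;> simp [front]; omega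

theorem sizeOf_front_lt {a : Worm} (ha : a ≠ one) : sizeOf a.front < sizeOf a := by
  cases a <;> simp [front] at *; omega

theorem sizeOf_rest_lt {a b : Worm} (hb : b ∈ a.rest) : sizeOf b < sizeOf a := by
  cases a <;> simp [rest] at *; subst hb; omega

/-- `A` implies `⟨k⟩B` in all worlds of the canonical model of `L`. -/
def Above (L : Formula → Prop) (k : ℕ) (a b : Worm) : Prop :=
  ∀ x : World L, x.Holds (a.toFormula k) → x.Holds (.dia k (b.toFormula k))

variable [ExtendsGLP L]

theorem dia_of_dia {k : ℕ} {a b : Formula} (h : ∀ x : World L, x.Holds a → x.Holds (.dia k b))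
    {x : World L} (hx : x.Holds (.dia k a)) : x.Holds (.dia k b) := by
  obtain ⟨y, hxy, hy⟩ := holds_dia.1 hx
  obtain ⟨z, hyz, hz⟩ := holds_dia.1 (h y hy)
  exact holds_dia.2 ⟨z, hxy.trans hyz, hz⟩

theorem dia_mono {k : ℕ} {a b : Formula} (h : ∀ x : World L, x.Holds a → x.Holds b)
    {x : World L} (hx : x.Holds (.dia k a)) : x.Holds (.dia k b) := by
  obtain ⟨y, hxy, hy⟩ := holds_dia.1 hx
  exact holds_dia.2 ⟨y, hxy, h y hy⟩

theorem Above.of_front {k : ℕ} {a b : Worm} (h : Above L (k + 1) a.front b.front)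
    (hb : ∀ c ∈ b.rest, Above L k a c) : Above L k a b := by
  intro x hx
  obtain ⟨y, hxy, hy⟩ := holds_dia.1 (h x (holds_iff_front_rest.1 hx).1)
  exact holds_dia.2 ⟨y, hxy.of_le k.le_succ, holds_iff_front_rest.2
    ⟨hy, fun c hc => (hxy.dia_iff k.lt_succ_self).1 (hb c hc x hx)⟩⟩

/-- Worms of the same level are linearly ordered up to equivalence. -/
theorem trichotomy (L : Formula → Prop) [ExtendsGLP L] (k : ℕ) (a b : Worm) :
    Above L k a b ∨ Above L k b a ∨
      ∀ x : World L, x.Holds (a.toFormula k) ↔ x.Holds (b.toFormula k) := by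
  by_cases hone : a = one ∧ b = one
  · rw [hone.1, hone.2]; exact .inr (.inr fun _ => Iff.rfl)
  have hfront : sizeOf a.front + sizeOf b.front < sizeOf a + sizeOf b := by
    have ha := sizeOf_front_le a
    have hb := sizeOf_front_le b
    by_cases h : a = one
    · have := sizeOf_front_lt fun h' => hone ⟨h, h'⟩
      omega
    · have := sizeOf_front_lt h
      omega
  by_cases hab : Above L k a b
  · exact .inl hab
  by_cases hba : Above L k b a
  · exact .inr (.inl hba)
  have ha : ∀ c ∈ a.rest, Above L k b c := by
    intro c hc
    have := sizeOf_rest_lt hc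
    rcases trichotomy L k c b with h | h | h
    · exact absurd (fun x hx => dia_of_dia h (holds_rest hc hx)) hab
    · exact h
    · exact absurd (fun x hx => dia_mono (fun y => (h y).1) (holds_rest hc hx)) hab
  have hb : ∀ c ∈ b.rest, Above L k a c := by
    intro c hc
    have := sizeOf_rest_lt hc
    rcases trichotomy L k c a with h | h | h
    · exact absurd (fun x hx => dia_of_dia h (holds_rest hc hx)) hba
    · exact h
    · exact absurd (fun x hx => dia_mono (fun y => (h y).1) (holds_rest hc hx)) hba
  rcases trichotomy L (k + 1) a.front b.front with h | h | h
  · exact absurd (.of_front h hb) hab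
  · exact absurd (.of_front h ha) hba
  · refine .inr (.inr fun x => ⟨fun hx => ?_, fun hx => ?_⟩)
    · exact holds_iff_front_rest.2
        ⟨(h x).1 (holds_iff_front_rest.1 hx).1, fun c hc => hb c hc x hx⟩
    · exact holds_iff_front_rest.2
        ⟨(h x).2 (holds_iff_front_rest.1 hx).1, fun c hc => ha c hc x hx⟩
termination_by sizeOf a + sizeOf b

/-- Worms of the same level are closed under conjunction up to equivalence. -/
theorem exists_conj (L : Formula → Prop) [ExtendsGLP L] (k : ℕ) (a b : Worm) :
    ∃ c : Worm, ∀ x : World L,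
      x.Holds (c.toFormula k) ↔ x.Holds (a.toFormula k) ∧ x.Holds (b.toFormula k) := by
  cases a with
  | one => exact ⟨b, by simp [toFormula, holds_top]⟩
  | up a =>
    cases b with
    | one => exact ⟨up a, by simp [toFormula, holds_top]⟩
    | up b =>
      obtain ⟨c, hc⟩ := exists_conj L (k + 1) a b
      exact ⟨up c, by simpa [toFormula] using hc⟩
    | node b b' =>
      obtain ⟨c, hc⟩ := exists_conj L (k + 1) a b
      exact ⟨node c b', by simp [toFormula, hc, and_assoc]⟩
  | node a a' =>
    cases b with
    | one => exact ⟨node a a', by simp [toFormula, holds_top]⟩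
    | up b =>
      obtain ⟨c, hc⟩ := exists_conj L (k + 1) a b
      exact ⟨node c a', by simp [toFormula, hc, and_assoc, and_comm]⟩
    | node b b' =>
      obtain ⟨c, hc⟩ := exists_conj L (k + 1) a b
      have hab : (∀ x : World L, x.Holds (.dia k (a'.toFormula k)) →
            x.Holds (.dia k (b'.toFormula k))) ∨
          (∀ x : World L, x.Holds (.dia k (b'.toFormula k)) →
            x.Holds (.dia k (a'.toFormula k))) := by
        rcases trichotomy L k a' b' with h | h | h
        · exact .inl fun x => dia_of_dia h
        · exact .inr fun x => dia_of_dia h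
        · exact .inl fun x => dia_mono fun y => (h y).1
      rcases hab with h | h
      · refine ⟨node c a', fun x => ?_⟩
        have := h x
        simp only [toFormula, holds_and, hc]
        tauto
      · refine ⟨node c b', fun x => ?_⟩
        have := h x
        simp only [toFormula, holds_and, hc]
        tauto

theorem toFormula_iterate_up (k i : ℕ) (a : Worm) :
    (up^[i] a).toFormula k = a.toFormula (k + i) := by
  induction i generalizing a with
  | zero => rfl
  | succ i ih => rw [Function.iterate_succ_apply, ih]; rfl

/-- The formula `⟨j⟩A`, where `A` is a worm of level `j`. -/
abbrev atom (p : ℕ × Worm) : Formula := .dia p.1 (p.2.toFormula p.1)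

theorem exists_conj_atoms (L : Formula → Prop) [ExtendsGLP L] (k : ℕ) (s : Finset (ℕ × Worm))
    (hs : ∀ p ∈ s, k ≤ p.1) :
    ∃ c : Worm, ∀ x : World L, x.Holds (c.toFormula k) ↔ ∀ p ∈ s, x.Holds (atom p) := by
  classical
  induction s using Finset.induction_on with
  | empty => exact ⟨one, by simp [toFormula, holds_top]⟩
  | insert p s _ ih =>
    obtain ⟨c, hc⟩ := ih fun q hq => hs q (Finset.mem_insert_of_mem hq)
    obtain ⟨d, hd⟩ := exists_conj L k (up^[p.1 - k] (node one p.2)) c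
    refine ⟨d, fun x => ?_⟩
    rw [hd, hc, toFormula_iterate_up, Nat.add_sub_cancel' (hs p (Finset.mem_insert_self _ _))]
    simp [toFormula, holds_top]

/-- If a world satisfies `A` but not `⟨k⟩A`, then it satisfies only those worms of level `k`
that hold in every world satisfying `A`. -/
theorem holds_of_minimal {k : ℕ} {a b : Worm} {x y : World L} (hx : x.Holds (a.toFormula k))
    (hy : y.Holds (a.toFormula k)) (hy' : ¬ y.Holds (.dia k (a.toFormula k)))
    (hb : y.Holds (b.toFormula k)) : x.Holds (b.toFormula k) := by
  obtain ⟨c, hc⟩ := exists_conj L k a b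
  rcases trichotomy L k c a with h | h | h
  · exact absurd (h y ((hc y).2 ⟨hy, hb⟩)) hy'
  · have hself : ∀ z : World L, z.Holds (a.toFormula k) → z.Holds (.dia k (a.toFormula k)) :=
      fun z hz => dia_mono (fun w hw => ((hc w).1 hw).1) (h z hz)
    exact absurd (hself y hy) hy'
  · exact ((hc x).1 ((h x).2 hx)).2

/-- For large `n`, the formula `⟨n⟩⊤` implies a given worm, and `[n]` preserves its truth value. -/
theorem eventually_holds (L : Formula → Prop) [ExtendsGLP L] (k : ℕ) (a : Worm) :
    ∃ N, ∀ n ≥ N, ∀ x : World L,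
      (x.Holds (.dia n .top) → x.Holds (a.toFormula k)) ∧
      ∀ y, Rel n x y → (x.Holds (a.toFormula k) ↔ y.Holds (a.toFormula k)) := by
  induction a generalizing k with
  | one => exact ⟨0, by simp [toFormula, holds_top]⟩
  | up a ih => exact ih (k + 1)
  | node a b iha ihb =>
    obtain ⟨N, hN⟩ := iha (k + 1)
    obtain ⟨M, hM⟩ := ihb k
    refine ⟨max (max N M) (k + 1), fun n hn x => ?_⟩
    have hn₁ : N ≤ n := by omega
    have hn₂ : M ≤ n := by omega
    have hn₃ : k < n := by omega
    simp only [toFormula, holds_and]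
    refine ⟨fun h => ⟨(hN n hn₁ x).1 h, ?_⟩, fun y hxy => ?_⟩
    · obtain ⟨y, hxy, -⟩ := holds_dia.1 h
      exact holds_dia.2 ⟨y, hxy.of_le hn₃.le, ((hM n hn₂ x).2 y hxy).1 ((hM n hn₂ x).1 h)⟩
    · rw [(hN n hn₁ x).2 y hxy, hxy.dia_iff hn₃]

/-- The truth of a closed formula in the canonical model is determined by the truth values of
finitely many formulas `⟨j⟩A` with `A` a worm of level `j`. -/
theorem exists_support (L : Formula → Prop) [ExtendsGLP L] {φ : Formula} (hφ : φ.Closed) :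
    ∃ s : Finset (ℕ × Worm), ∀ x y : World L,
      (∀ p ∈ s, x.Holds (atom p) ↔ y.Holds (atom p)) → (x.Holds φ ↔ y.Holds φ) := by
  classical
  have binary : ∀ {a b : Formula} (s t : Finset (ℕ × Worm)),
      (∀ x y : World L, (∀ p ∈ s, x.Holds (atom p) ↔ y.Holds (atom p)) →
        (x.Holds a ↔ y.Holds a)) →
      (∀ x y : World L, (∀ p ∈ t, x.Holds (atom p) ↔ y.Holds (atom p)) →
        (x.Holds b ↔ y.Holds b)) →
      ∀ x y : World L, (∀ p ∈ s ∪ t, x.Holds (atom p) ↔ y.Holds (atom p)) →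
        (x.Holds a ↔ y.Holds a) ∧ (x.Holds b ↔ y.Holds b) := fun s t ha hb x y h =>
    ⟨ha x y fun p hp => h p (Finset.mem_union_left _ hp),
      hb x y fun p hp => h p (Finset.mem_union_right _ hp)⟩
  induction φ with
  | var => exact hφ.elim
  | top => exact ⟨∅, by simp [holds_top]⟩
  | neg a ih =>
    obtain ⟨s, hs⟩ := ih hφ
    exact ⟨s, fun x y h => by rw [holds_neg, holds_neg, hs x y h]⟩
  | and a b iha ihb | or a b iha ihb | imp a b iha ihb =>
    obtain ⟨s, hs⟩ := iha hφ.1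
    obtain ⟨t, ht⟩ := ihb hφ.2
    refine ⟨s ∪ t, fun x y h => ?_⟩
    obtain ⟨h₁, h₂⟩ := binary s t hs ht x y h
    simp only [holds_and, holds_or, holds_imp, h₁, h₂]
  | box k a ih =>
    obtain ⟨s, hs⟩ := ih hφ
    choose c hc using fun t : Finset (ℕ × Worm) =>
      exists_conj_atoms L k (t.filter fun p => k ≤ p.1) (by simp)
    refine ⟨s.filter (fun p => p.1 < k) ∪ s.powerset.image fun t => (k, c t), ?_⟩
    suffices ∀ x y : World L, (∀ p ∈ s.filter (fun p => p.1 < k) ∪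
        s.powerset.image fun t => (k, c t), x.Holds (atom p) ↔ y.Holds (atom p)) →
        y.Holds (.box k a) → x.Holds (.box k a) from
      fun x y h => ⟨this y x fun p hp => (h p hp).symm, this x y h⟩
    intro x y h hy
    refine holds_box.2 fun u hxu => ?_
    have hxE : x.Holds (atom (k, c (s.filter fun p => u.Holds (atom p)))) :=
      holds_dia.2 ⟨u, hxu, (hc _ u).2 (by simp +contextual)⟩
    have hyE := (h _ (Finset.mem_union_right _ (Finset.mem_image_of_mem _
      (Finset.mem_powerset.2 (Finset.filter_subset _ s))))).1 hxE
    obtain ⟨w, hyw, hw, hw'⟩ := lob_dia hyE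
    refine (hs u w fun p hp => ?_).2 (hyw _ hy)
    rcases lt_or_ge p.1 k with hpk | hpk
    · rw [← hxu.dia_iff hpk, ← hyw.dia_iff hpk]
      exact h p (Finset.mem_union_left _ (Finset.mem_filter.2 ⟨hp, hpk⟩))
    · refine ⟨fun hup => (hc _ w).1 hw p (by simp [hp, hpk, hup]), fun hwp => ?_⟩
      have hform : ∀ z : World L, z.Holds ((up^[p.1 - k] (node one p.2)).toFormula k) ↔
          z.Holds (atom p) := fun z => by
        rw [toFormula_iterate_up, Nat.add_sub_cancel' hpk]
        simp [toFormula, holds_top]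
      exact (hform u).1 (holds_of_minimal ((hc _ u).2 (by simp +contextual)) hw hw'
        ((hform w).2 hwp))

/-- A closed formula unprovable in `L` is refuted at some world below any world satisfying
`⟨n⟩⊤`, for large `n`. -/
theorem exists_refutation_of_closed {φ : Formula} (hφ : φ.Closed) (h : ¬ L φ) :
    ∃ n, L (.imp (.box 0 φ) (.box n .bot)) := by
  classical
  obtain ⟨u, hu⟩ : ∃ u : World L, ¬ u.Holds φ := by
    by_contra! hall
    exact h (complete hall)
  obtain ⟨s, hs⟩ := exists_support L hφ
  obtain ⟨c, hc⟩ := exists_conj_atoms L 0 (s.filter fun p => u.Holds (atom p)) (by simp)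
  obtain ⟨N, hN⟩ := eventually_holds L 0 c
  have huc := (hc u).2 (by simp +contextual)
  refine ⟨N, complete fun x => holds_imp.2 fun hx => holds_box.2 fun y hxy => ?_⟩
  have hxc := (hN N le_rfl x).1 (holds_dia.2 ⟨y, hxy, holds_top y⟩)
  obtain ⟨w, hxw, hw, hw'⟩ := lob_dia (holds_dia.2
    ⟨y, hxy.of_le N.zero_le, ((hN N le_rfl x).2 y hxy).1 hxc⟩)
  refine absurd ?_ hu
  refine (hs u w fun p hp => ⟨fun hup => (hc w).1 hw p (by simp [hp, hup]), fun hwp => ?_⟩).2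
    (hxw _ hx)
  have hform : ∀ z : World L, z.Holds ((up^[p.1] (node one p.2)).toFormula 0) ↔
      z.Holds (atom p) := fun z => by
    rw [toFormula_iterate_up, Nat.zero_add]
    simp [toFormula, holds_top]
  exact (hform u).1 (holds_of_minimal huc hw hw' ((hform w).2 hwp))

end Worm

/-! ### Ignatiev's model -/

namespace Ignatiev

open Ordinal

/-- `b` is at most the exponent of the last term of the Cantor normal form of `a`. -/
def LeExponent (a b : Ordinal.{0}) : Prop := b ≠ 0 → a ≠ 0 ∧ ω ^ b ∣ a

theorem LeExponent.mono {a b c : Ordinal.{0}} (h : LeExponent a b) (hcb : c ≤ b) :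
    LeExponent a c := fun hc =>
  have := h (fun hb => hc (le_zero_iff.1 (hb ▸ hcb)))
  ⟨this.1, (opow_dvd_opow ω hcb).trans this.2⟩

theorem LeExponent.exists_between {a b c d : Ordinal.{0}} (h : LeExponent a b) (hc : c < b)
    (hd : d < a) : ∃ z, d < z ∧ z < a ∧ LeExponent z c := by
  obtain ⟨-, q, rfl⟩ := h (ne_bot_of_gt hc)
  have hpos : (0 : Ordinal) < ω ^ c := opow_pos _ omega0_pos
  refine ⟨ω ^ c * Order.succ (d / ω ^ c), lt_mul_succ_div _ hpos.ne', ?_, fun _ =>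
    ⟨mul_ne_zero hpos.ne' (Order.succ_ne_bot _), dvd_mul_right _ _⟩⟩
  obtain ⟨e, rfl⟩ := exists_add_of_le hc.le
  rw [opow_add, mul_assoc] at hd ⊢
  refine (mul_lt_mul_iff_right₀ hpos).2 ?_
  have hlt : d / ω ^ c < ω ^ e * q := (lt_mul_iff_div_lt hpos.ne').1 hd
  have he : e ≠ 0 := by rintro rfl; simp at hc
  have hq : q ≠ 0 := by rintro rfl; simp at hlt
  exact (isSuccLimit_mul_left (isSuccLimit_opow_left isSuccLimit_omega0 he)
    (pos_iff_ne_zero.2 hq)).succ_lt hlt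

/-- Points of Ignatiev's model: sequences of ordinals in which every entry is bounded by the
exponent of the last term of the preceding one. -/
def Point : Type 1 := {x : ℕ → Ordinal.{0} // ∀ i, LeExponent (x i) (x (i + 1))}

/-- The accessibility relations of Ignatiev's model. -/
def rel (k : ℕ) (x y : Point) : Prop := (∀ i < k, x.1 i = y.1 i) ∧ y.1 k < x.1 k

/-- Truth in Ignatiev's model, with all variables false. -/
abbrev Truth (x : Point) (φ : Formula) : Prop := Sat rel (fun _ _ => False) x φ

theorem rel_trans {k : ℕ} {x y z : Point} (h₁ : rel k x y) (h₂ : rel k y z) : rel k x z :=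
  ⟨fun i hi => (h₁.1 i hi).trans (h₂.1 i hi), h₂.2.trans h₁.2⟩

theorem rel_congr {k m : ℕ} (hkm : k < m) {x y z : Point} (h : rel m x y) :
    rel k x z ↔ rel k y z := by
  simp only [rel, h.1 k hkm]
  exact and_congr_left' (forall₂_congr fun i hi => by rw [h.1 i (hi.trans hkm)])

/-- Two points agree on a pair `(i, c)` if their `i`-th entries lie on the same side of `c`. -/
def Agree (s : Finset (ℕ × Ordinal.{0})) (x y : Point) : Prop :=
  ∀ p ∈ s, p.2 < x.1 p.1 ↔ p.2 < y.1 p.1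

theorem Agree.symm {s : Finset (ℕ × Ordinal.{0})} {x y : Point} (h : Agree s x y) :
    Agree s y x := fun p hp => (h p hp).symm

/-- The point obtained from `x` by replacing its tail from position `k` on by that of `y`. -/
def splice (k : ℕ) (x y : Point) (h : y.1 k ≤ x.1 k) : Point :=
  ⟨fun i => if i < k then x.1 i else y.1 i, fun i => by
    rcases lt_trichotomy (i + 1) k with hi | hi | hi
    · simpa [hi, show i < k by omega] using x.2 i
    · subst hi
      simpa using (x.2 i).mono h
    · simpa [show ¬ i < k by omega, show ¬ i + 1 < k by omega] using y.2 i⟩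

theorem exists_support (φ : Formula) :
    ∃ s : Finset (ℕ × Ordinal.{0}), ∀ x y : Point, Agree s x y → (Truth x φ ↔ Truth y φ) := by
  classical
  induction φ with
  | var => exact ⟨∅, by simp [Sat]⟩
  | top => exact ⟨∅, by simp [Sat]⟩
  | neg a ih =>
    obtain ⟨s, hs⟩ := ih
    exact ⟨s, fun x y h => not_congr (hs x y h)⟩
  | and a b iha ihb | or a b iha ihb | imp a b iha ihb =>
    obtain ⟨s, hs⟩ := iha
    obtain ⟨t, ht⟩ := ihb
    refine ⟨s ∪ t, fun x y h => ?_⟩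
    have h₁ := hs x y fun p hp => h p (Finset.mem_union_left _ hp)
    have h₂ := ht x y fun p hp => h p (Finset.mem_union_right _ hp)
    simp only [Truth, Sat] at h₁ h₂ ⊢
    rw [h₁, h₂]
  | box k a ih =>
    obtain ⟨s, hs⟩ := ih
    let m : Finset (ℕ × Ordinal.{0}) → Ordinal.{0} := fun t =>
      sInf {c | ∃ u : Point, ¬ Truth u a ∧ (s.filter fun p => p.2 < u.1 p.1) = t ∧ u.1 k = c}
    refine ⟨s.filter (fun p => p.1 < k) ∪ s.powerset.image fun t => (k, m t), ?_⟩
    suffices ∀ x y : Point, Agree (s.filter (fun p => p.1 < k) ∪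
        s.powerset.image fun t => (k, m t)) x y → Truth y (.box k a) → Truth x (.box k a) from
      fun x y h => ⟨this y x h.symm, this x y h⟩
    intro x y h hy u hxu
    by_contra hu
    set t := s.filter fun p => p.2 < u.1 p.1 with ht
    obtain ⟨w, hw, hwt, hwm⟩ : ∃ w : Point, ¬ Truth w a ∧
        (s.filter fun p => p.2 < w.1 p.1) = t ∧ w.1 k = m t :=
      csInf_mem (s := {c | ∃ u : Point, ¬ Truth u a ∧
        (s.filter fun p => p.2 < u.1 p.1) = t ∧ u.1 k = c}) ⟨_, u, hu, rfl, rfl⟩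
    have hmu : m t ≤ u.1 k := csInf_le' ⟨u, hu, rfl, rfl⟩
    have hmy : m t < y.1 k := (h (k, m t) (Finset.mem_union_right _ (Finset.mem_image_of_mem _
      (Finset.mem_powerset.2 (Finset.filter_subset _ s))))).1 (hmu.trans_lt hxu.2)
    have hwu : Agree s w u := fun p hp => by
      have := Finset.ext_iff.1 hwt p
      simpa [ht, hp] using this
    have hwy : w.1 k ≤ y.1 k := hwm ▸ hmy.le
    refine hw ((hs (splice k y w hwy) w fun p hp => ?_).1 (hy _ ⟨fun i hi => ?_, ?_⟩))
    · rcases lt_or_ge p.1 k with hpk | hpk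
      · rw [hwu p hp, ← hxu.1 _ hpk,
          h p (Finset.mem_union_left _ (Finset.mem_filter.2 ⟨hp, hpk⟩))]
        simp [splice, hpk]
      · simp [splice, hpk.not_gt]
    · simp [splice, hi]
    · simpa [splice, hwm] using hmy

theorem truth_mono {k : ℕ} {φ : Formula} {x : Point} (h : Truth x (.box k φ)) :
    Truth x (.box (k + 1) φ) := by
  classical
  intro y hxy
  obtain ⟨s, hs⟩ := exists_support φ
  have hpos : 0 < x.1 k :=
    pos_iff_ne_zero.2 (x.2 k (ne_bot_of_gt hxy.2)).1
  obtain ⟨d, hd, hds⟩ : ∃ d < x.1 k, ∀ p ∈ s, p.2 < x.1 k → p.2 ≤ d :=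
    ⟨(s.filter fun p => p.2 < x.1 k).sup Prod.snd, (Finset.sup_lt_iff hpos).2 (by simp),
      fun p hp hpx => Finset.le_sup (f := Prod.snd) (Finset.mem_filter.2 ⟨hp, hpx⟩)⟩
  obtain ⟨z, hdz, hzx, hz⟩ := (x.2 k).exists_between hxy.2 hd
  have hyk : y.1 k = x.1 k := (hxy.1 k k.lt_succ_self).symm
  let w : Point := ⟨Function.update y.1 k z, fun i => by
    rcases eq_or_ne i k with rfl | hi
    · simpa using hz
    · rw [Function.update_of_ne hi]
      rcases eq_or_ne (i + 1) k with rfl | hi'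
      · simpa using (y.2 i).mono (hyk ▸ hzx.le)
      · rw [Function.update_of_ne hi']
        exact y.2 i⟩
  refine (hs w y fun p hp => ?_).1 (h w ⟨fun i hi => ?_, ?_⟩)
  · rcases eq_or_ne p.1 k with hpk | hpk
    · simp only [w, hpk, Function.update_self, hyk]
      exact ⟨fun h => h.trans hzx, fun h => (hds p hp h).trans_lt hdz⟩
    · simp [w, hpk]
  · simp only [w, Function.update_of_ne hi.ne]
    exact hxy.1 i (hi.trans k.lt_succ_self)
  · simpa [w] using hzx

theorem truth_mono_le {k m : ℕ} (hkm : k ≤ m) {φ : Formula} {x : Point}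
    (h : Truth x (.box k φ)) : Truth x (.box m φ) := by
  induction m, hkm using Nat.le_induction with
  | base => exact h
  | succ m _ ih => exact truth_mono ih

theorem eq_or_rel {k : ℕ} {x y z : Point} (hy : rel k x y) (hz : rel k x z) :
    y = z ∨ ∃ j ≥ k, rel j y z ∨ rel j z y := by
  classical
  by_cases h : ∃ j, y.1 j ≠ z.1 j
  · refine .inr ⟨Nat.find h, ?_, ?_⟩
    · by_contra! hlt
      exact Nat.find_spec h ((hy.1 _ hlt).symm.trans (hz.1 _ hlt))
    · have heq : ∀ i < Nat.find h, y.1 i = z.1 i := fun i hi => by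
        simpa using Nat.find_min h hi
      rcases lt_or_gt_of_ne (Nat.find_spec h) with hlt | hlt
      · exact .inr ⟨fun i hi => (heq i hi).symm, hlt⟩
      · exact .inl ⟨heq, hlt⟩
  · push Not at h
    exact .inl (Subtype.ext (funext h))

theorem truth_lob {k : ℕ} {φ : Formula} {x : Point}
    (h : Truth x (.box k (.imp (.box k φ) φ))) : Truth x (.box k φ) := by
  have key : ∀ c : Ordinal.{0}, ∀ y, rel k x y → y.1 k = c → Truth y φ := by
    intro c
    induction c using WellFoundedLT.induction with
    | ind c ih =>
      rintro y hxy rfl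
      exact h y hxy fun z hyz => ih _ hyz.2 z (rel_trans hxy hyz) rfl
  exact fun y hxy => key _ y hxy rfl

/-- `GLP.3` is sound with respect to Ignatiev's model. -/
theorem sound {φ : Formula} (h : GLP3 φ) (x : Point) : Truth x φ := by
  classical
  induction h generalizing x with
  | taut h =>
    have := h (fun ψ => decide (Truth x ψ))
      ⟨by simp [Sat], by simp [Sat], by simp [Sat], by simp [Sat], by simp [Sat, imp_iff_not_or]⟩
    simpa using this
  | distr m φ ψ => exact fun h₁ h₂ y hy => h₁ y hy (h₂ y hy)
  | lob m φ => exact truth_lob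
  | mono m φ => exact truth_mono
  | diaMono m φ => exact fun h y hy hneg => h fun z hz => hneg z ((rel_congr m.lt_succ_self hy).1 hz)
  | lin m a b =>
    by_contra hx
    simp only [Truth, Sat, not_or, not_forall] at hx
    obtain ⟨⟨y, hy, hya, hyb⟩, z, hz, ⟨hzb, hzb'⟩, hza⟩ := hx
    rcases eq_or_rel hy hz with rfl | ⟨j, hj, h | h⟩
    · exact hyb hzb'
    · exact hza (truth_mono_le (φ := a) hj hya z h)
    · exact hyb (truth_mono_le (φ := b) hj hzb y h)
  | mp _ _ h₁ h₂ => exact h₁ x (h₂ x)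
  | nec m _ ih => exact fun y _ => ih y

/-- For every `m` and `c` there is a point with `m`-th entry `c` and zero entries beyond. -/
theorem exists_point (m : ℕ) (c : Ordinal.{0}) :
    ∃ x : Point, x.1 m = c ∧ ∀ i > m, x.1 i = 0 := by
  induction m generalizing c with
  | zero =>
    exact ⟨⟨fun i => if i = 0 then c else 0, fun i h => absurd (by simp) h⟩, by simp,
      fun i hi => by simp [hi.ne']⟩
  | succ m ih =>
    obtain ⟨x, hx, hx0⟩ := ih (ω ^ c)
    refine ⟨⟨Function.update x.1 (m + 1) c, fun i => ?_⟩, by simp, fun i hi => ?_⟩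
    · rcases lt_trichotomy i m with hi | rfl | hi
      · rw [Function.update_of_ne (by omega), Function.update_of_ne (by omega)]
        exact x.2 i
      · rw [Function.update_of_ne (by omega), Function.update_self, hx]
        exact fun _ => ⟨(opow_pos _ omega0_pos).ne', dvd_rfl⟩
      · rw [Function.update_of_ne (a := i + 1) (by omega), hx0 _ (by omega)]
        exact fun h => absurd rfl h
    · show Function.update x.1 (m + 1) c i = 0
      rw [Function.update_of_ne (by omega), hx0 _ (by omega)]

theorem not_truth_iterate_box (m k : ℕ) {x : Point} (hx : x.1 m = k)
    (hx0 : ∀ i > m, x.1 i = 0) : ¬ Truth x ((fun ψ => Formula.box m ψ)^[k] .bot) := by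
  induction k generalizing x with
  | zero => simp [Formula.bot, Sat]
  | succ k ih =>
    obtain ⟨y, hy, hy0⟩ := exists_point m k
    have hlt : y.1 m < x.1 m := by rw [hx, hy]; exact_mod_cast k.lt_succ_self
    rw [Function.iterate_succ_apply']
    refine fun h => ih (x := splice m x y hlt.le) (by simp [splice, hy])
      (fun i hi => ?_) (h _ ⟨fun i hi => ?_, ?_⟩)
    · simp [splice, hi.not_gt, hy0 i hi]
    · simp [splice, hi]
    · simpa [splice] using hlt

theorem not_glp3_iterate_box (m k : ℕ) :
    ¬ GLP3 ((fun ψ => Formula.box m ψ)^[k] .bot) := fun h =>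
  have ⟨x, hx, hx0⟩ := exists_point m k
  not_truth_iterate_box m k hx hx0 (sound h x)

end Ignatiev

/-! ### Closed refutations of formulas unprovable in `GLP.3` -/

/-- The pairs `(m, a)` such that `[m]a` is a subformula. -/
def Formula.boxes : Formula → Finset (ℕ × Formula)
  | .var _ => ∅
  | .top => ∅
  | .neg a => a.boxes
  | .and a b => a.boxes ∪ b.boxes
  | .or a b => a.boxes ∪ b.boxes
  | .imp a b => a.boxes ∪ b.boxes
  | .box m a => insert (m, a) a.boxes

open World

/-- A finite family of `GLP.3`-worlds generated by `x` via the relations `Rel m` with `k ≤ m`,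
together with mutually exclusive closed formulas `form i`, such that in the canonical model of
`GLP` the worlds satisfying `form i` simulate the world `point i` with respect to the formulas
`[m]a` for `(m, a) ∈ Φ` and `k ≤ m`. -/
structure ClosedDescription (Φ : Finset (ℕ × Formula)) (n k : ℕ) (x : World GLP3) where
  ι : Type
  [fintype : Fintype ι]
  form : ι → Formula
  point : ι → World GLP3
  root : ι
  closed : ∀ i, (form i).Closed
  point_root : point root = x
  rel_point : ∀ i ≠ root, Rel k x (point i)
  exclusive : ∀ (u : World GLP) i j, u.Holds (form i) → u.Holds (form j) → i = j
  back : ∀ (u : World GLP) i, u.Holds (form i) → ∀ m ≥ k, ∀ a, (m, a) ∈ Φ →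
    ¬ (point i).Holds (.box m a) →
      ∃ v j, Rel m u v ∧ v.Holds (form j) ∧ ¬ (point j).Holds a
  forth : ∀ (u : World GLP) i, u.Holds (form i) → ∀ m ≥ k, ∀ v, Rel m u v →
    ∃ j ≠ root, v.Holds (form j) ∧
      ∀ a, (m, a) ∈ Φ → (point i).Holds (.box m a) → (point j).Holds a
  reach : ∀ u : World GLP, u.Holds (.dia n .top) → u.Holds (.dia k (form root))
  cover : ∀ u : World GLP, (∃ i, u.Holds (form i)) ∨ u.Holds (.dia k (form root))

namespace ClosedDescription

variable {Φ : Finset (ℕ × Formula)} {n k : ℕ} {x y : World GLP3}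

attribute [instance] ClosedDescription.fintype

theorem holds_box_point (D : ClosedDescription Φ n (k + 1) x) (i : D.ι) {a : Formula} :
    (D.point i).Holds (.box k a) ↔ x.Holds (.box k a) := by
  by_cases hi : i = D.root
  · rw [hi, D.point_root]
  · exact ((D.rel_point i hi).box_iff k.lt_succ_self).symm

/-- The one-point description at the highest level. -/
def single (hn : ∀ p ∈ Φ, p.1 < n) (x : World GLP3) : ClosedDescription Φ n n x where
  ι := Unit
  form _ := .box n .bot
  point _ := x
  root := ()
  closed _ := trivial
  point_root := rfl
  rel_point i hi := absurd rfl hi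
  exclusive _ _ _ _ _ := rfl
  back _ _ _ m hm a ha := absurd (hn _ ha) hm.not_gt
  forth u _ hu m hm v huv := absurd (huv.of_le hm _ hu) (not_holds_bot v)
  reach u hu := by
    obtain ⟨v, huv, hv, -⟩ := lob_box (holds_neg.1 hu)
    exact holds_dia.2 ⟨v, huv, hv⟩
  cover u := by
    by_cases hu : u.Holds (.box n .bot)
    · exact .inl ⟨(), hu⟩
    · obtain ⟨v, huv, hv, -⟩ := lob_box hu
      exact .inr (holds_dia.2 ⟨v, huv, hv⟩)

/-- A description at level `k + 1` of a world that satisfies all relevant formulas `[k]a` yields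
one at level `k`. -/
def lift (D : ClosedDescription Φ n (k + 1) x)
    (hx : ∀ a, (k, a) ∈ Φ → x.Holds (.box k a)) : ClosedDescription Φ n k x where
  ι := D.ι
  form i := .and (.neg (.dia k (D.form D.root))) (D.form i)
  point := D.point
  root := D.root
  closed i := ⟨D.closed D.root, D.closed i⟩
  point_root := D.point_root
  rel_point i hi := (D.rel_point i hi).of_le k.le_succ
  exclusive u i j hi hj := D.exclusive u i j (holds_and.1 hi).2 (holds_and.1 hj).2
  back u i hu m hm a ha hia := by
    obtain ⟨hu₁, hu₂⟩ := holds_and.1 hu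
    rcases hm.eq_or_lt with rfl | hkm
    · exact absurd ((D.holds_box_point i).2 (hx a ha)) hia
    · obtain ⟨v, j, huv, hv, hja⟩ := D.back u i hu₂ m hkm a ha hia
      exact ⟨v, j, huv, holds_and.2 ⟨by rwa [holds_neg, ← huv.dia_iff hkm, ← holds_neg], hv⟩, hja⟩
  forth u i hu m hm v huv := by
    obtain ⟨hu₁, hu₂⟩ := holds_and.1 hu
    rw [holds_neg] at hu₁
    rcases hm.eq_or_lt with rfl | hkm
    · have hv : ¬ v.Holds (.dia k (D.form D.root)) := fun hv => by
        obtain ⟨w, hvw, hw⟩ := holds_dia.1 hv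
        exact hu₁ (holds_dia.2 ⟨w, huv.trans hvw, hw⟩)
      rcases D.cover v with ⟨j, hj⟩ | hv'
      · have hjr : j ≠ D.root := by
          rintro rfl
          exact hu₁ (holds_dia.2 ⟨v, huv, hj⟩)
        exact ⟨j, hjr, holds_and.2 ⟨holds_neg.2 hv, hj⟩, fun a _ hia =>
          (D.rel_point j hjr).of_le k.le_succ _ ((D.holds_box_point i).1 hia)⟩
      · obtain ⟨w, hvw, hw⟩ := holds_dia.1 hv'
        exact absurd (holds_dia.2 ⟨w, hvw.of_le k.le_succ, hw⟩) hv
    · obtain ⟨j, hjr, hj, hja⟩ := D.forth u i hu₂ m hkm v huv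
      exact ⟨j, hjr, holds_and.2 ⟨by rwa [holds_neg, ← huv.dia_iff hkm], hj⟩, hja⟩
  reach u hu := by
    obtain ⟨v, huv, hv⟩ := holds_dia.1 (D.reach u hu)
    obtain ⟨w, huw, hw, hw'⟩ := lob_dia (holds_dia.2 ⟨v, huv.of_le k.le_succ, hv⟩)
    exact holds_dia.2 ⟨w, huw, holds_and.2 ⟨holds_neg.2 hw', hw⟩⟩
  cover u := by
    by_cases hu : u.Holds (.dia k (D.form D.root))
    · obtain ⟨w, huw, hw, hw'⟩ := lob_dia hu
      exact .inr (holds_dia.2 ⟨w, huw, holds_and.2 ⟨holds_neg.2 hw', hw⟩⟩)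
    · rcases D.cover u with ⟨j, hj⟩ | hu'
      · exact .inl ⟨j, holds_and.2 ⟨holds_neg.2 hu, hj⟩⟩
      · obtain ⟨w, hvw, hw⟩ := holds_dia.1 hu'
        exact absurd (holds_dia.2 ⟨w, hvw.of_le k.le_succ, hw⟩) hu

/-- A description of `y` at level `k` can be placed below a description of `x` at level `k + 1`
if `y` is a suitable `Rel k`-successor of `x`. -/
def append (D : ClosedDescription Φ n k y) (D' : ClosedDescription Φ n (k + 1) x)
    (hxy : Rel k x y) (hx : ∀ a, (k, a) ∈ Φ → ¬ x.Holds (.box k a) →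
      ¬ y.Holds a ∨ ¬ y.Holds (.box k a)) : ClosedDescription Φ n k x :=
  let e : Formula := .dia k (D.form D.root)
  let t : Formula := .and e (D'.form D'.root)
  have rel_inl (j : D.ι) : Rel k x (D.point j) := by
    by_cases hj : j = D.root
    · rwa [hj, D.point_root]
    · exact hxy.trans (D.rel_point j hj)
  have not_e {u : World GLP} {j : D.ι} (hu : u.Holds (D.form j)) : ¬ u.Holds e := fun he => by
    obtain ⟨v, huv, hv⟩ := holds_dia.1 he
    obtain ⟨i, hi, hvi, -⟩ := D.forth u j hu k le_rfl v huv
    exact hi (D.exclusive v _ _ hvi hv)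
  have seen {u : World GLP} (he : u.Holds e)
      (hu : u.Holds (.dia (k + 1) (D'.form D'.root))) : u.Holds (.dia k t) := by
    obtain ⟨v, huv, hv⟩ := holds_dia.1 hu
    exact holds_dia.2 ⟨v, huv.of_le k.le_succ,
      holds_and.2 ⟨(huv.dia_iff k.lt_succ_self).1 he, hv⟩⟩
  have lob {u : World GLP} (hu : u.Holds (.dia k t)) :
      u.Holds (.dia k (.and e (.and (.neg (.dia k t)) (D'.form D'.root)))) := by
    obtain ⟨v, huv, hv, hv'⟩ := lob_dia hu
    obtain ⟨hv₁, hv₂⟩ := holds_and.1 hv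
    exact holds_dia.2 ⟨v, huv, holds_and.2 ⟨hv₁, holds_and.2 ⟨holds_neg.2 hv', hv₂⟩⟩⟩
  { ι := D.ι ⊕ D'.ι
    form := Sum.elim D.form fun i => .and e (.and (.neg (.dia k t)) (D'.form i))
    point := Sum.elim D.point D'.point
    root := .inr D'.root
    closed := by
      rintro (i | i)
      · exact D.closed i
      · exact ⟨D.closed _, ⟨D.closed _, D'.closed _⟩, D'.closed _⟩
    point_root := D'.point_root
    rel_point := by
      rintro (i | i) hi
      · exact rel_inl i
      · exact (D'.rel_point i fun h => hi (h ▸ rfl)).of_le k.le_succ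
    exclusive := by
      rintro u (i | i) (j | j) hi hj
      · exact congrArg _ (D.exclusive u i j hi hj)
      · exact absurd (holds_and.1 hj).1 (not_e hi)
      · exact absurd (holds_and.1 hi).1 (not_e hj)
      · exact congrArg _ (D'.exclusive u i j (holds_and.1 (holds_and.1 hi).2).2
          (holds_and.1 (holds_and.1 hj).2).2)
    back := by
      rintro u (i | i) hu m hm a ha hia
      · obtain ⟨v, j, huv, hv, hja⟩ := D.back u i hu m hm a ha hia
        exact ⟨v, .inl j, huv, hv, hja⟩
      · obtain ⟨hu₁, hu⟩ := holds_and.1 hu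
        obtain ⟨hu₂, hu₃⟩ := holds_and.1 hu
        rcases hm.eq_or_lt with rfl | hkm
        · obtain ⟨v, huv, hv⟩ := holds_dia.1 hu₁
          rcases hx a ha fun h => hia ((D'.holds_box_point i).2 h) with h | h
          · exact ⟨v, .inl D.root, huv, hv, by simpa [D.point_root] using h⟩
          · obtain ⟨w, j, hvw, hw, hja⟩ := D.back v D.root hv k le_rfl a ha
              (by rwa [D.point_root])
            exact ⟨w, .inl j, huv.trans hvw, hw, hja⟩
        · obtain ⟨v, j, huv, hv, hja⟩ := D'.back u i hu₃ m hkm a ha hia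
          refine ⟨v, .inr j, huv, holds_and.2 ⟨(huv.dia_iff hkm).1 hu₁, holds_and.2 ⟨?_, hv⟩⟩, hja⟩
          rwa [holds_neg, ← huv.dia_iff hkm, ← holds_neg]
    forth := by
      rintro u (i | i) hu m hm v huv
      · obtain ⟨j, -, hj, hja⟩ := D.forth u i hu m hm v huv
        exact ⟨.inl j, Sum.inl_ne_inr, hj, hja⟩
      · obtain ⟨hu₁, hu⟩ := holds_and.1 hu
        obtain ⟨hu₂, hu₃⟩ := holds_and.1 hu
        rw [holds_neg] at hu₂
        rcases hm.eq_or_lt with rfl | hkm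
        · have hv : ¬ v.Holds (.dia k t) := fun hv => by
            obtain ⟨w, hvw, hw⟩ := holds_dia.1 hv
            exact hu₂ (holds_dia.2 ⟨w, huv.trans hvw, hw⟩)
          rcases D.cover v with ⟨j, hj⟩ | he
          · exact ⟨.inl j, Sum.inl_ne_inr, hj, fun a _ hia =>
              rel_inl j _ ((D'.holds_box_point i).1 hia)⟩
          rcases D'.cover v with ⟨j, hj⟩ | hv'
          · have hjr : j ≠ D'.root := by
              rintro rfl
              exact hu₂ (holds_dia.2 ⟨v, huv, holds_and.2 ⟨he, hj⟩⟩)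
            exact ⟨.inr j, fun h => hjr (Sum.inr_injective h),
              holds_and.2 ⟨he, holds_and.2 ⟨holds_neg.2 hv, hj⟩⟩, fun a _ hia =>
              (D'.rel_point j hjr).of_le k.le_succ _ ((D'.holds_box_point i).1 hia)⟩
          · exact absurd (seen he hv') hv
        · obtain ⟨j, hjr, hj, hja⟩ := D'.forth u i hu₃ m hkm v huv
          refine ⟨.inr j, fun h => hjr (Sum.inr_injective h),
            holds_and.2 ⟨(huv.dia_iff hkm).1 hu₁, holds_and.2 ⟨?_, hj⟩⟩, hja⟩
          rwa [holds_neg, ← huv.dia_iff hkm]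
    reach := fun u hu => lob (seen (D.reach u hu) (D'.reach u hu))
    cover := fun u => by
      by_cases hu : u.Holds (.dia k t)
      · exact .inr (lob hu)
      rcases D.cover u with ⟨j, hj⟩ | he
      · exact .inl ⟨.inl j, hj⟩
      rcases D'.cover u with ⟨j, hj⟩ | hu'
      · exact .inl ⟨.inr j, holds_and.2 ⟨he, holds_and.2 ⟨holds_neg.2 hu, hj⟩⟩⟩
      · exact absurd (seen he hu') hu }

open Classical in
/-- The relevant formulas `[k]a` failing at `x`. -/
noncomputable def failing (Φ : Finset (ℕ × Formula)) (k : ℕ) (x : World GLP3) :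
    Finset (ℕ × Formula) :=
  Φ.filter fun p => p.1 = k ∧ ¬ x.Holds (.box k p.2)

theorem mem_failing {a : Formula} :
    (k, a) ∈ failing Φ k x ↔ (k, a) ∈ Φ ∧ ¬ x.Holds (.box k a) := by
  simp [failing]

theorem failing_fst {p : ℕ × Formula} (hp : p ∈ failing Φ k x) : p.1 = k := by
  classical exact (Finset.mem_filter.1 hp).2.1

theorem failing_ssubset (hxy : Rel k x y) {a : Formula} (ha : (k, a) ∈ Φ)
    (hx : ¬ x.Holds (.box k a)) (hy : y.Holds (.box k a)) :
    failing Φ k y ⊂ failing Φ k x := by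
  refine (Finset.ssubset_iff_of_subset fun p hp => ?_).2
    ⟨(k, a), mem_failing.2 ⟨ha, hx⟩, fun h => (mem_failing.1 h).2 hy⟩
  obtain ⟨m, b⟩ := p
  obtain rfl : m = k := failing_fst hp
  rw [mem_failing] at hp ⊢
  exact ⟨hp.1, fun h => hp.2 (hxy _ (box_box h))⟩

/-- A world refuting some relevant formula `[k]a` has a `Rel k`-successor as required by
`ClosedDescription.append` that refutes fewer relevant formulas. -/
theorem exists_successor {a : Formula} (ha : (k, a) ∈ Φ) (hx : ¬ x.Holds (.box k a)) :
    ∃ y, Rel k x y ∧ failing Φ k y ⊂ failing Φ k x ∧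
      ∀ b, (k, b) ∈ Φ → ¬ x.Holds (.box k b) → ¬ y.Holds b ∨ ¬ y.Holds (.box k b) := by
  let S : Set (World GLP3) := {y | Rel k x y ∧
    ∃ b, (k, b) ∈ Φ ∧ ¬ x.Holds (.box k b) ∧ y.Holds (.box k b) ∧ ¬ y.Holds b}
  have hS : S.Nonempty := by
    obtain ⟨y, hxy, h₁, h₂⟩ := lob_box hx
    exact ⟨y, hxy, a, ha, hx, h₁, h₂⟩
  obtain ⟨y, ⟨hxy, b, hb, hxb, hyb, hyb'⟩, hmax⟩ :=
    (measure fun y => Φ.card - (failing Φ k y).card).wf.has_min S hS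
  refine ⟨y, hxy, failing_ssubset hxy hb hxb hyb, fun c hc hxc => ?_⟩
  by_contra! hyc
  obtain ⟨z, hxz, hzc, hzc'⟩ := lob_box hxc
  rcases Rel.linear hxy hxz with rfl | h | h
  · exact hzc' hyc.1
  · exact hzc' (h _ hyc.2)
  · refine hmax z ⟨hxz, c, hc, hxc, hzc, hzc'⟩ ?_
    have hlt := Finset.card_lt_card (failing_ssubset h hb (fun hzb => hyb' (h _ hzb)) hyb)
    have hle : (failing Φ k z).card ≤ Φ.card := by
      classical exact Finset.card_filter_le _ _
    show Φ.card - (failing Φ k z).card < Φ.card - (failing Φ k y).card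
    omega

theorem nonempty (hn : ∀ p ∈ Φ, p.1 < n) (hk : k ≤ n) (x : World GLP3) :
    Nonempty (ClosedDescription Φ n k x) := by
  induction hk using Nat.decreasingInduction generalizing x with
  | self => exact ⟨single hn x⟩
  | of_succ k hk ih =>
    induction hs : failing Φ k x using Finset.strongInduction generalizing x with
    | H s ihs =>
      subst hs
      obtain ⟨D'⟩ := ih x
      by_cases hx : ∀ a, (k, a) ∈ Φ → x.Holds (.box k a)
      · exact ⟨D'.lift hx⟩
      push Not at hx
      obtain ⟨a, ha, hxa⟩ := hx
      obtain ⟨y, hxy, hlt, hy⟩ := exists_successor ha hxa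
      obtain ⟨D⟩ := ihs _ hlt y rfl
      exact ⟨D.append D' hxy hy⟩

/-- The disjunction of a finite list of formulas. -/
def disj (l : List Formula) : Formula := l.foldr .or .bot

theorem holds_disj {u : World GLP} {l : List Formula} :
    u.Holds (disj l) ↔ ∃ a ∈ l, u.Holds a := by
  induction l with
  | nil => simp [disj, not_holds_bot]
  | cons a l ih => simpa [disj] using or_congr_right ih

theorem closed_disj {l : List Formula} (h : ∀ a ∈ l, a.Closed) : (disj l).Closed := by
  induction l with
  | nil => trivial
  | cons a l ih => exact ⟨h a (by simp), ih fun b hb => h b (by simp [hb])⟩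

open Classical in
/-- The closed substitution defining a variable by the descriptions of the worlds satisfying it. -/
noncomputable def substitution (D : ClosedDescription Φ n k x) (p : ℕ) : Formula :=
  disj ((Finset.univ.filter fun i => (D.point i).Holds (.var p)).toList.map D.form)

theorem closed_substitution (D : ClosedDescription Φ n k x) (p : ℕ) :
    (D.substitution p).Closed :=
  closed_disj fun a ha => by
    obtain ⟨i, -, rfl⟩ := List.mem_map.1 ha
    exact D.closed i

theorem holds_subst (D : ClosedDescription Φ n 0 x) {φ : Formula} (hφ : φ.boxes ⊆ Φ)
    {u : World GLP} {i : D.ι} (hu : u.Holds (D.form i)) :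
    u.Holds (φ.subst D.substitution) ↔ (D.point i).Holds φ := by
  induction φ generalizing u i with
  | var p =>
    simp only [Formula.subst, substitution, holds_disj, List.mem_map, Finset.mem_toList,
      Finset.mem_filter, Finset.mem_univ, true_and, exists_exists_and_eq_and]
    exact ⟨fun ⟨j, hj, huj⟩ => D.exclusive u i j hu huj ▸ hj, fun h => ⟨i, h, hu⟩⟩
  | top => exact iff_of_true (holds_top u) (holds_top _)
  | neg a ih => rw [Formula.subst, holds_neg, holds_neg, ih hφ hu]
  | and a b iha ihb | or a b iha ihb | imp a b iha ihb =>
    obtain ⟨ha, hb⟩ := Finset.union_subset_iff.1 hφ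
    simp only [Formula.subst, holds_and, holds_or, holds_imp, iha ha hu, ihb hb hu]
  | box m a ih =>
    obtain ⟨hm, ha⟩ := Finset.insert_subset_iff.1 hφ
    refine ⟨fun h => ?_, fun h => holds_box.2 fun v huv => ?_⟩
    · by_contra hi
      obtain ⟨v, j, huv, hv, hja⟩ := D.back u i hu m m.zero_le a hm hi
      exact hja ((ih ha hv).1 (huv _ h))
    · obtain ⟨j, -, hv, hja⟩ := D.forth u i hu m m.zero_le v huv
      exact (ih ha hv).2 (hja a hm h)

end ClosedDescription

/-- A formula unprovable in `GLP.3` has a closed substitution that is refuted, provably in `GLP`,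
below every world satisfying `⟨n⟩⊤` for some `n`. -/
theorem exists_closed_refutation {φ : Formula} (h : ¬ GLP3 φ) :
    ∃ σ : ℕ → Formula, (∀ i, (σ i).Closed) ∧
      ∃ n, GLP (.imp (.box 0 (φ.subst σ)) (.box n .bot)) := by
  obtain ⟨x, hx⟩ : ∃ x : World GLP3, ¬ x.Holds φ := by
    by_contra! hall
    exact h (complete hall)
  obtain ⟨D⟩ := ClosedDescription.nonempty (Φ := φ.boxes) (n := φ.boxes.sup Prod.fst + 1)
    (fun p hp => Nat.lt_succ_of_le (Finset.le_sup (f := Prod.fst) hp)) (Nat.zero_le _) x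
  refine ⟨D.substitution, D.closed_substitution, φ.boxes.sup Prod.fst + 1,
    complete fun u => holds_imp.2 fun hu => ?_⟩
  by_contra hn
  obtain ⟨v, huv, hv⟩ := holds_dia.1 (D.reach u (holds_neg.2 hn))
  exact hx (D.point_root ▸ (D.holds_subst subset_rfl hv).1 (huv _ hu))

/-! ### `GLP.3` as the largest non-degenerate normal extension of `GLP` -/

theorem GLP.glp3 {φ : Formula} (h : GLP φ) : GLP3 φ := by
  induction h with
  | taut h => exact .taut h
  | distr m φ ψ => exact .distr m φ ψ
  | lob m φ => exact .lob m φ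
  | mono m φ => exact .mono m φ
  | diaMono m φ => exact .diaMono m φ
  | mp _ _ h₁ h₂ => exact .mp h₁ h₂
  | nec m _ h => exact .nec m h

theorem Tautology.subst {φ : Formula} (h : Tautology φ) (σ : ℕ → Formula) :
    Tautology (φ.subst σ) := fun v hv =>
  h (fun ψ => v (ψ.subst σ)) ⟨hv.1, fun _ => hv.2.1 _, fun _ _ => hv.2.2.1 _ _,
    fun _ _ => hv.2.2.2.1 _ _, fun _ _ => hv.2.2.2.2 _ _⟩

theorem GLP3.subst {φ : Formula} (h : GLP3 φ) (σ : ℕ → Formula) : GLP3 (φ.subst σ) := by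
  induction h with
  | taut h => exact .taut (h.subst σ)
  | distr m φ ψ => exact .distr m _ _
  | lob m φ => exact .lob m _
  | mono m φ => exact .mono m _
  | diaMono m φ => exact .diaMono m (φ.subst σ)
  | lin m a b => exact .lin m _ _
  | mp _ _ h₁ h₂ => exact .mp h₁ h₂
  | nec m _ h => exact .nec m h

theorem Formula.closed_subst {σ : ℕ → Formula} (hσ : ∀ i, (σ i).Closed) (φ : Formula) :
    (φ.subst σ).Closed := by
  induction φ with
  | var i => exact hσ i
  | top => trivial
  | neg a ih => exact ih
  | and a b iha ihb | or a b iha ihb | imp a b iha ihb => exact ⟨iha, ihb⟩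
  | box m a ih => exact ih

/-- `GLP.3` is a non-degenerate normal extension of `GLP`; it contains every
non-degenerate normal extension of `GLP` (so it is the largest one); and it
equals the set of formulas all of whose closed substitutions are `GLP`-theorems. -/
theorem glp3_largest :
    NormalExtGLP {φ : Formula | GLP3 φ} ∧
    NonDegenerate {φ : Formula | GLP3 φ} ∧
    (∀ S : Set Formula, NormalExtGLP S → NonDegenerate S → S ⊆ {φ : Formula | GLP3 φ}) ∧
    {φ : Formula | GLP3 φ} =
      {φ : Formula | ∀ σ : ℕ → Formula, (∀ i, Formula.Closed (σ i)) → GLP (Formula.subst σ φ)} := by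
  refine ⟨⟨fun _ => GLP.glp3, .distr, fun _ _ => .mp, fun m _ => .nec m, fun σ _ h => h.subst σ⟩,
    Ignatiev.not_glp3_iterate_box, ?_, ?_⟩
  · rintro S ⟨hglp, -, hmp, hnec, hsubst⟩ hS φ hφ
    by_contra h
    obtain ⟨σ, -, n, hn⟩ := exists_closed_refutation h
    exact hS n 1 (hmp _ _ (hglp _ hn) (hnec 0 _ (hsubst σ φ hφ)))
  · refine Set.Subset.antisymm (fun φ hφ σ hσ => ?_) fun φ hφ => ?_
    · by_contra h
      obtain ⟨n, hn⟩ := Worm.exists_refutation_of_closed (φ.closed_subst hσ) h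
      exact Ignatiev.not_glp3_iterate_box n 1 (.mp hn.glp3 (.nec 0 (GLP3.subst hφ σ)))
    · by_contra h
      obtain ⟨σ, hσ, n, hn⟩ := exists_closed_refutation h
      exact Ignatiev.not_glp3_iterate_box n 1 (.mp hn.glp3 (.nec 0 (hφ σ hσ).glp3))
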